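/- For a finite MDP with discount factor γ ∈ [0,1), there exists a unique function v* : S → ℝ satisfying the Bellman optimality equation for the state-value function: v*(s) = max_{a∈A} (R(s,a) + γ ∑_{s'∈S} P(s,a)(s') · v*(s')) for all s ∈ S. -/

import Mathlib

theorem PMF.sum_toReal_eq_one {S : Type*} [Fintype S] (p : PMF S) :
    ∑ s, (p s).toReal = 1 := by
  rw [← ENNReal.toReal_sum fun s _ => p.apply_ne_top s, ← tsum_fintype (L := .unconditional S),
    p.tsum_coe, ENNReal.toReal_one]

theorem PMF.sum_toReal_mul_le_add_dist {S : Type*} [Fintype S] (p : PMF S) (v w : S → ℝ) :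
    ∑ s, (p s).toReal * v s ≤ ∑ s, (p s).toReal * w s + dist v w := by
  calc
    ∑ s, (p s).toReal * v s ≤ ∑ s, (p s).toReal * (w s + dist v w) := by
      gcongr with s
      have h := (le_abs_self _).trans ((Real.dist_eq _ _).symm.trans_le (dist_le_pi_dist v w s))
      linarith
    _ = ∑ s, (p s).toReal * w s + dist v w := by
      simp only [mul_add, Finset.sum_add_distrib]
      rw [← Finset.sum_mul, p.sum_toReal_eq_one, one_mul]

/-- The Bellman optimality operator of a finite Markov decision process. -/
noncomputable def bellmanOperator {S A : Type*} [Fintype S] [Fintype A] [Nonempty A]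
    (P : S → A → PMF S) (R : S → A → ℝ) (γ : ℝ) (v : S → ℝ) (s : S) : ℝ :=
  Finset.univ.sup' Finset.univ_nonempty
    (fun a : A => R s a + γ * ∑ s', ((P s a) s').toReal * v s')

theorem bellmanOperator_le_add_dist {S A : Type*} [Fintype S] [Fintype A] [Nonempty A]
    (P : S → A → PMF S) (R : S → A → ℝ) {γ : ℝ} (hγ0 : 0 ≤ γ) (v w : S → ℝ) (s : S) :
    bellmanOperator P R γ v s ≤ bellmanOperator P R γ w s + γ * dist v w := by
  refine Finset.sup'_le _ _ fun a ha => ?_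
  have h := mul_le_mul_of_nonneg_left ((P s a).sum_toReal_mul_le_add_dist v w) hγ0
  have hw : R s a + γ * ∑ s', ((P s a) s').toReal * w s' ≤ bellmanOperator P R γ w s :=
    Finset.le_sup' (fun a : A => R s a + γ * ∑ s', ((P s a) s').toReal * w s') ha
  linarith

theorem contractingWith_bellmanOperator {S A : Type*} [Fintype S] [Fintype A] [Nonempty A]
    (P : S → A → PMF S) (R : S → A → ℝ) {γ : ℝ} (hγ0 : 0 ≤ γ) (hγ1 : γ < 1) :
    ContractingWith (NNReal.mk γ hγ0) (bellmanOperator P R γ) := by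
  refine ⟨hγ1, LipschitzWith.of_dist_le_mul fun v w => ?_⟩
  refine (dist_pi_le_iff (by positivity)).2 fun s => ?_
  rw [Real.dist_eq, abs_sub_le_iff, NNReal.coe_mk]
  have h₁ := bellmanOperator_le_add_dist P R hγ0 v w s
  have h₂ := bellmanOperator_le_add_dist P R hγ0 w v s
  rw [dist_comm w v] at h₂
  constructor <;> linarith


/-- For a finite MDP with discount `γ ∈ [0,1)`, there exists a unique
`v* : S → ℝ` satisfying the Bellman optimality equation for the state-value function. -/
theorem bellman_optimality_equation_existsUnique
    {S A : Type*} [Fintype S] [Fintype A] [Nonempty S] [Nonempty A]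
    (P : S → A → PMF S) (R : S → A → ℝ)
    (γ : ℝ) (hγ0 : 0 ≤ γ) (hγ1 : γ < 1) :
    ∃! v : S → ℝ, ∀ s, v s =
      Finset.univ.sup' Finset.univ_nonempty
        (fun a : A => R s a + γ * ∑ s', ((P s a) s').toReal * v s') := by
  have hc := contractingWith_bellmanOperator P R hγ0 hγ1
  refine ⟨hc.fixedPoint, fun s => (congrFun hc.fixedPoint_isFixedPt s).symm, fun v hv => ?_⟩
  exact hc.fixedPoint_unique (funext fun s => (hv s).symm)
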